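/- arXiv:1409.2161 — 4 statements merged into one kernel-verified Lean document; each statement's English description precedes it below -/
import Mathlib

section
/- Fix d ∈ ℕ and 0 < η ≤ 1/2. Let C ⊂ D_j and let {C_1, …, C_d} be a fixed (η,d)-homogeneous colouring of C. Let U ⊂ D_j be disjoint from C and such that the pair (C, U) is d-previsible. Then there exists a decomposition U = U_1 ∪ … ∪ U_d such that {H_i = C_i ∪ U_i : 1 ≤ i ≤ d} is an (η,d)-homogeneous colouring of H = C ∪ U. -/
/-- Encoding of dyadic intervals: an interval of `D_j` (the dyadic intervals of length
`2 ^ (-j)` in `[0,1]`) is encoded by its position `i < 2 ^ j`, representing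
`[i / 2 ^ j, (i + 1) / 2 ^ j]`; a dyadic testing interval `L ∈ D` with `|L| ≥ 2 ^ (-j)` is
encoded by a scale `k ≤ j` and a position `m < 2 ^ k`, representing
`[m / 2 ^ k, (m + 1) / 2 ^ k]`.  For a collection `C ⊆ D_j`, `restrict j k m C` is the
subcollection `C ∩ L = {i ∈ C : i ⊆ L}` of elements of `C` contained in the testing
interval `L = [m / 2 ^ k, (m + 1) / 2 ^ k]`. -/
def restrict (j k m : ℕ) (C : Finset ℕ) : Finset ℕ :=
  C.filter fun i => i / 2 ^ (j - k) = m

/-- `col` is a decomposition of `C` into `d` pairwise disjoint (possibly empty) classes. -/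
def IsColouring (d : ℕ) (C : Finset ℕ) (col : Fin d → Finset ℕ) : Prop :=
  (∀ i, col i ⊆ C) ∧ (∀ i₁ i₂ : Fin d, i₁ ≠ i₂ → Disjoint (col i₁) (col i₂)) ∧
    ∀ x ∈ C, ∃ i, x ∈ col i

/-- `col` is an `(η, d)`-homogeneous colouring of `C ⊆ D_j`: it is a decomposition of `C`
into `d` pairwise disjoint classes such that for every dyadic testing interval `L` of
length `≥ 2 ^ (-j)`, either `|C ∩ L| > d` and
`η * max_{1 ≤ i ≤ d} |C_i ∩ L| ≤ min_{1 ≤ i ≤ d} |C_i ∩ L|`, or else `|C ∩ L| ≤ d` and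
`|C_i ∩ L| ≤ 1` for every `1 ≤ i ≤ d`. -/
def IsHomogeneous (j d : ℕ) (η : ℝ) (C : Finset ℕ) (col : Fin d → Finset ℕ) : Prop :=
  IsColouring d C col ∧
    ∀ k ≤ j, ∀ m < 2 ^ k,
      (d < (restrict j k m C).card ∧
        ∀ i₁ i₂ : Fin d,
          η * (restrict j k m (col i₁)).card ≤ ((restrict j k m (col i₂)).card : ℝ)) ∨
      ((restrict j k m C).card ≤ d ∧ ∀ i : Fin d, (restrict j k m (col i)).card ≤ 1)

/-- The pair `(C, U)` of (disjoint) collections in `D_j` is `d`-previsible: for every dyadic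
interval `L` of length `≥ 2 ^ (-(j - 1))` with immediate dyadic successors `L'`, `L''`
(the two halves of `L`, in either order), the conditions `|(C ∪ U) ∩ L'| < d` and
`|(C ∪ U) ∩ L''| ≥ d` imply `U ∩ L'' = ∅` or `C ∩ L'' = ∅`. -/
def Previsible (j d : ℕ) (C U : Finset ℕ) : Prop :=
  ∀ k, k + 1 ≤ j → ∀ m < 2 ^ k, ∀ m' m'' : ℕ,
    (m' = 2 * m ∧ m'' = 2 * m + 1) ∨ (m' = 2 * m + 1 ∧ m'' = 2 * m) →
    (restrict j (k + 1) m' (C ∪ U)).card < d →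
    d ≤ (restrict j (k + 1) m'' (C ∪ U)).card →
    restrict j (k + 1) m'' U = ∅ ∨ restrict j (k + 1) m'' C = ∅

/-- The number of elements of `S` which receive the colour `i` under `f`. -/
def colourCount {d : ℕ} (f : ℕ → Fin d) (S : Finset ℕ) (i : Fin d) : ℕ :=
  (S.filter fun x => f x = i).card

/-- Every colour class of `f` on `S` has at least `η` times the size of any other one. -/
def BalancedOn {d : ℕ} (η : ℝ) (f : ℕ → Fin d) (S : Finset ℕ) : Prop :=
  ∀ i₁ i₂ : Fin d, η * (colourCount f S i₁ : ℝ) ≤ (colourCount f S i₂ : ℝ)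

/-- The homogeneity condition for the colouring `f` on a single set `S`. -/
def GoodOn {d : ℕ} (η : ℝ) (f : ℕ → Fin d) (S : Finset ℕ) : Prop :=
  (d < S.card ∧ BalancedOn η f S) ∨ (S.card ≤ d ∧ ∀ i, colourCount f S i ≤ 1)

/-- The homogeneity condition for the colouring `f` of `H` on every dyadic interval contained
in the interval of scale `k` and position `m`. -/
def GoodBelow {d : ℕ} (j : ℕ) (η : ℝ) (H : Finset ℕ) (f : ℕ → Fin d) (k m : ℕ) : Prop :=
  ∀ k', k ≤ k' → k' ≤ j → ∀ m', m' / 2 ^ (k' - k) = m → GoodOn η f (restrict j k' m' H)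

section Counting

variable {d : ℕ} {f g : ℕ → Fin d} {S T : Finset ℕ}

lemma colourCount_congr (h : ∀ x ∈ S, f x = g x) (i : Fin d) :
    colourCount f S i = colourCount g S i := by
  unfold colourCount
  congr 1
  exact Finset.filter_congr fun x hx => by rw [h x hx]

lemma colourCount_union (h : Disjoint S T) (i : Fin d) :
    colourCount f (S ∪ T) i = colourCount f S i + colourCount f T i := by
  unfold colourCount
  rw [Finset.filter_union, Finset.card_union_of_disjoint (Finset.disjoint_filter_filter h)]

lemma colourCount_mono (h : S ⊆ T) (i : Fin d) : colourCount f S i ≤ colourCount f T i :=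
  Finset.card_le_card (Finset.filter_subset_filter _ h)

lemma sum_colourCount (f : ℕ → Fin d) (S : Finset ℕ) : ∑ i, colourCount f S i = S.card :=
  (Finset.card_eq_sum_card_fiberwise fun _ _ => Finset.mem_coe.2 (Finset.mem_univ _)).symm

lemma colourCount_pos_iff {i : Fin d} : 0 < colourCount f S i ↔ i ∈ S.image f := by
  simp [colourCount, Finset.card_pos, Finset.Nonempty]

lemma injOn_of_colourCount_le_one (h : ∀ i, colourCount f S i ≤ 1) : Set.InjOn f S := by
  intro x hx y hy hxy
  exact Finset.card_le_one.1 (h (f y)) x (by simpa [hxy] using hx) y (by simpa using hy)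

lemma card_image_of_colourCount_le_one (h : ∀ i, colourCount f S i ≤ 1) :
    (S.image f).card = S.card :=
  Finset.card_image_of_injOn (injOn_of_colourCount_le_one h)

lemma colourCount_eq_ite (h : ∀ i, colourCount f S i ≤ 1) (i : Fin d) :
    colourCount f S i = if i ∈ S.image f then 1 else 0 := by
  have h1 := h i
  have h2 := colourCount_pos_iff (f := f) (S := S) (i := i)
  split_ifs with hi
  · have := h2.2 hi
    omega
  · have : ¬ 0 < colourCount f S i := fun h => hi (h2.1 h)
    omega

lemma BalancedOn.union {η : ℝ} (hS : BalancedOn η f S) (hT : BalancedOn η f T)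
    (h : Disjoint S T) : BalancedOn η f (S ∪ T) := by
  intro i₁ i₂
  rw [colourCount_union h, colourCount_union h]
  push_cast
  linarith [hS i₁ i₂, hT i₁ i₂]

lemma GoodOn.congr {η : ℝ} (hf : GoodOn η f S) (h : ∀ x ∈ S, f x = g x) : GoodOn η g S := by
  simpa only [GoodOn, BalancedOn, colourCount_congr h] using hf

lemma GoodOn.colourCount_le_one {η : ℝ} (hf : GoodOn η f S) (h : S.card ≤ d) (i : Fin d) :
    colourCount f S i ≤ 1 := by
  rcases hf with hf | hf
  · exact absurd hf.1 (by omega)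
  · exact hf.2 i

lemma colourCount_eq_one_of_card_eq (h : ∀ i, colourCount f S i ≤ 1) (hS : S.card = d)
    (i : Fin d) : colourCount f S i = 1 := by
  have hsum : ∑ i, colourCount f S i = ∑ _i : Fin d, 1 := by
    rw [sum_colourCount, hS]; simp
  exact (Finset.sum_eq_sum_iff_of_le fun i _ => h i).1 hsum i (Finset.mem_univ i)

lemma GoodOn.balancedOn {η : ℝ} (hη : η ≤ 1 / 2) (hf : GoodOn η f S) (h : d ≤ S.card) :
    BalancedOn η f S := by
  rcases hf with hf | hf
  · exact hf.2
  · intro i₁ i₂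
    have hone := colourCount_eq_one_of_card_eq hf.2 (le_antisymm hf.1 h)
    rw [hone, hone]
    norm_num
    linarith

lemma BalancedOn.colourCount_pos {η : ℝ} (hη : 0 < η) (hf : BalancedOn η f S)
    (hS : S.Nonempty) (i : Fin d) : 0 < colourCount f S i := by
  obtain ⟨x, hx⟩ := hS
  have h1 : 0 < colourCount f S (f x) := colourCount_pos_iff.2 (Finset.mem_image_of_mem f hx)
  have h2 : (0 : ℝ) < colourCount f S (f x) := by exact_mod_cast h1
  have := (mul_pos hη h2).trans_le (hf (f x) i)
  exact_mod_cast this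

/-- An equitable colouring satisfies the homogeneity condition. -/
lemma goodOn_of_equitable {η : ℝ} (hη : η ≤ 1 / 2)
    (h : ∀ i₁ i₂, colourCount f S i₁ ≤ colourCount f S i₂ + 1) : GoodOn η f S := by
  rcases lt_or_ge d S.card with hS | hS
  · refine Or.inl ⟨hS, fun i₁ i₂ => ?_⟩
    have hpos : 1 ≤ colourCount f S i₂ := by
      by_contra! hlt
      have hle : ∑ i, colourCount f S i ≤ ∑ _i : Fin d, 1 :=
        Finset.sum_le_sum fun i _ => by have := h i i₂; omega
      rw [sum_colourCount] at hle
      simp at hle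
      omega
    have h1 : (1 : ℝ) ≤ colourCount f S i₂ := by exact_mod_cast hpos
    have h2 : (colourCount f S i₁ : ℝ) ≤ colourCount f S i₂ + 1 := by exact_mod_cast h i₁ i₂
    nlinarith
  · refine Or.inr ⟨hS, fun i => ?_⟩
    by_contra! hlt
    have hle : ∑ _i : Fin d, 1 < ∑ i, colourCount f S i :=
      Finset.sum_lt_sum (fun i' _ => by have := h i i'; omega) ⟨i, Finset.mem_univ i, hlt⟩
    rw [sum_colourCount] at hle
    simp at hle
    omega

end Counting

section Extension

variable {d : ℕ}

/-- An injective colouring of `W` extends injectively to `V` by the colours of `Q`. -/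
lemma exists_injective_extension (c : ℕ → Fin d) {W V : Finset ℕ} {Q : Finset (Fin d)}
    (hWV : Disjoint W V) (hc : ∀ i, colourCount c W i ≤ 1)
    (hQ : Disjoint (W.image c) Q) (hcard : Q.card = V.card) :
    ∃ f : ℕ → Fin d, (∀ x, x ∉ V → f x = c x) ∧
      ∀ i, colourCount f (W ∪ V) i = if i ∈ W.image c ∪ Q then 1 else 0 := by
  let e : V ≃ Q := Finset.equivOfCardEq hcard.symm
  let f : ℕ → Fin d := fun x => if hx : x ∈ V then (e ⟨x, hx⟩ : Fin d) else c x
  have hfV : ∀ x (hx : x ∈ V), f x = e ⟨x, hx⟩ := fun x hx => by simp [f, hx]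
  have hf : ∀ x, x ∉ V → f x = c x := fun x hx => by simp [f, hx]
  have hfW : ∀ x ∈ W, f x = c x := fun x hx => hf x (Finset.disjoint_left.1 hWV hx)
  have himage : V.image f = Q := by
    ext i
    simp only [Finset.mem_image]
    constructor
    · rintro ⟨x, hx, rfl⟩
      rw [hfV x hx]
      exact (e ⟨x, hx⟩).2
    · intro hi
      refine ⟨e.symm ⟨i, hi⟩, (e.symm ⟨i, hi⟩).2, ?_⟩
      rw [hfV _ (e.symm ⟨i, hi⟩).2]
      simp
  have hcV : ∀ i, colourCount f V i ≤ 1 := by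
    intro i
    refine Finset.card_le_one.2 fun x hx y hy => ?_
    rw [Finset.mem_filter] at hx hy
    have := hx.2.trans hy.2.symm
    rw [hfV x hx.1, hfV y hy.1] at this
    simpa using e.injective (Subtype.ext this)
  refine ⟨f, hf, fun i => ?_⟩
  rw [colourCount_union hWV, colourCount_congr hfW, colourCount_eq_ite hc,
    colourCount_eq_ite hcV, himage]
  have := fun h : i ∈ W.image c => Finset.disjoint_left.1 hQ h
  by_cases h1 : i ∈ W.image c
  · simp [h1, this h1]
  · simp only [h1, Finset.mem_union, if_false, false_or, zero_add]

/-- Colours for two sets of sizes `u₁`, `u₂`, avoiding `P₁` and `P₂` respectively, can be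
chosen to exhaust all colours. -/
lemma exists_covering_colours {P₁ P₂ : Finset (Fin d)} {u₁ u₂ : ℕ}
    (h₁ : P₁.card + u₁ ≤ d) (h₂ : P₂.card + u₂ ≤ d) (h : (P₁ ∪ P₂)ᶜ.card ≤ u₁ + u₂) :
    ∃ Q₁ Q₂ : Finset (Fin d), Disjoint P₁ Q₁ ∧ Disjoint P₂ Q₂ ∧ Q₁.card = u₁ ∧
      Q₂.card = u₂ ∧ ∀ i, i ∈ P₁ ∪ Q₁ ∨ i ∈ P₂ ∪ Q₂ := by
  obtain ⟨B, hBA, hB⟩ := Finset.exists_subset_card_eq (min_le_right u₁ (P₁ ∪ P₂)ᶜ.card)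
  have c₁ : P₁ᶜ.card = d - P₁.card := by rw [Finset.card_compl, Fintype.card_fin]
  have c₂ : P₂ᶜ.card = d - P₂.card := by rw [Finset.card_compl, Fintype.card_fin]
  have hsd := Finset.card_sdiff_add_card_eq_card hBA
  have s₁ : B ⊆ P₁ᶜ := hBA.trans (Finset.compl_subset_compl.2 Finset.subset_union_left)
  have s₂ : (P₁ ∪ P₂)ᶜ \ B ⊆ P₂ᶜ :=
    Finset.sdiff_subset.trans (Finset.compl_subset_compl.2 Finset.subset_union_right)
  obtain ⟨Q₁, hBQ₁, hQ₁, hc₁⟩ := Finset.exists_subsuperset_card_eq (n := u₁) s₁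
    (by omega) (by omega)
  obtain ⟨Q₂, hBQ₂, hQ₂, hc₂⟩ := Finset.exists_subsuperset_card_eq (n := u₂) s₂
    (by omega) (by omega)
  refine ⟨Q₁, Q₂, Finset.disjoint_left.2 fun i hi hq => Finset.mem_compl.1 (hQ₁ hq) hi,
    Finset.disjoint_left.2 fun i hi hq => Finset.mem_compl.1 (hQ₂ hq) hi, hc₁, hc₂,
    fun i => ?_⟩
  have a₁ := @hBQ₁ i
  have a₂ := @hBQ₂ i
  simp only [Finset.mem_sdiff, Finset.mem_compl, Finset.mem_union] at a₁ a₂ ⊢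
  tauto

/-- A finite set has a subset of any admissible size which consists of minimizers of `w`. -/
lemma exists_subset_card_eq_of_minimal {α : Type*} [DecidableEq α] (w : α → ℕ)
    (K : Finset α) (u : ℕ) (hu : u ≤ K.card) :
    ∃ Q ⊆ K, Q.card = u ∧ ∀ q ∈ Q, ∀ x ∈ K, x ∉ Q → w q ≤ w x := by
  induction u with
  | zero => exact ⟨∅, by simp⟩
  | succ u ih =>
    obtain ⟨Q, hQK, hQ, hmin⟩ := ih (by omega)
    have hne : (K \ Q).Nonempty := by
      rw [← Finset.card_pos]
      have := Finset.card_sdiff_add_card_eq_card hQK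
      omega
    obtain ⟨a, ha, hamin⟩ := Finset.exists_min_image (K \ Q) w hne
    rw [Finset.mem_sdiff] at ha
    refine ⟨insert a Q, Finset.insert_subset ha.1 hQK, by simp [ha.2, hQ], ?_⟩
    intro q hq x hx hxQ
    rw [Finset.mem_insert, not_or] at hxQ
    rcases Finset.mem_insert.1 hq with rfl | hq
    · exact hamin x (Finset.mem_sdiff.2 ⟨hx, hxQ.2⟩)
    · exact hmin q hq x hx hxQ.2

/-- Colouring the elements of `V` cyclically in increasing order is equitable on all
intervals; the colours which occur once more than the others can be prescribed. -/
lemma exists_cyclic_colouring (hd : 0 < d) (c : ℕ → Fin d) (V : Finset ℕ)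
    {T : Finset (Fin d)} (hT : T.card = V.card % d) :
    ∃ f : ℕ → Fin d, (∀ x, x ∉ V → f x = c x) ∧
      (∀ i, colourCount f V i = V.card / d + if i ∈ T then 1 else 0) ∧
      ∀ a b, ∀ i₁ i₂, colourCount f (V.filter fun x => a ≤ x ∧ x < b) i₁ ≤
        colourCount f (V.filter fun x => a ≤ x ∧ x < b) i₂ + 1 := by
  have hlt : V.card % d < d := Nat.mod_lt _ hd
  let rank : ℕ → ℕ := fun a => (V.filter fun x => x < a).card
  have hrank_mono : Monotone rank := fun a b hab =>
    Finset.card_le_card fun x hx => by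
      rw [Finset.mem_filter] at hx ⊢
      exact ⟨hx.1, hx.2.trans_le hab⟩
  have hrank_lt : ∀ x ∈ V, ∀ b, x < b → rank x < rank b := fun x hx b hb =>
    Finset.card_lt_card ⟨fun y hy => by
      rw [Finset.mem_filter] at hy ⊢
      exact ⟨hy.1, hy.2.trans hb⟩, fun h => by
      have := h (Finset.mem_filter.2 ⟨hx, hb⟩)
      simp at this⟩
  have hT' : (Finset.univ.filter fun i : Fin d => (i : ℕ) < V.card % d).card = T.card := by
    rw [hT, Fin.card_filter_val_lt]
    omega
  obtain ⟨e, he⟩ : ∃ e : Fin d ≃ Fin d, ∀ i, i ∈ T ↔ ((e i : Fin d) : ℕ) < V.card % d := by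
    let e₀ : {i : Fin d // i ∈ T} ≃ {i : Fin d // (i : ℕ) < V.card % d} :=
      Fintype.equivOfCardEq (by rw [Fintype.card_coe, Fintype.card_subtype, hT'])
    refine ⟨e₀.extendSubtype, fun i => ⟨fun hi => e₀.extendSubtype_mem i hi, fun hi => ?_⟩⟩
    by_contra hn
    exact e₀.extendSubtype_not_mem i hn hi
  let f : ℕ → Fin d := fun x =>
    if x ∈ V then e.symm ⟨rank x % d, Nat.mod_lt _ hd⟩ else c x
  have hfe : ∀ x ∈ V, ∀ i, f x = i ↔ rank x ≡ (e i : ℕ) [MOD d] := by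
    intro x hx i
    simp only [f, hx, if_true, Equiv.symm_apply_eq, Fin.ext_iff, Nat.ModEq,
      Nat.mod_eq_of_lt (e i).2]
  have hprefix : ∀ b i, colourCount f (V.filter fun x => x < b) i =
      rank b / d + if (e i : ℕ) < rank b % d then 1 else 0 := by
    intro b i
    have hcount := Nat.count_modEq_card (rank b) hd (e i : ℕ)
    rw [Nat.mod_eq_of_lt (e i).2] at hcount
    rw [← hcount, Nat.count_eq_card_filter_range]
    have hinj : Set.InjOn rank (V.filter fun x => x < b) := by
      intro x hx y hy hxy
      have hx := (Finset.mem_filter.1 (Finset.mem_coe.1 hx)).1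
      have hy := (Finset.mem_filter.1 (Finset.mem_coe.1 hy)).1
      rcases lt_trichotomy x y with h | h | h
      · exact absurd hxy (hrank_lt x hx y h).ne
      · exact h
      · exact absurd hxy (hrank_lt y hy x h).ne'
    have himage : (V.filter fun x => x < b).image rank = Finset.range (rank b) := by
      refine Finset.eq_of_subset_of_card_le (fun r hr => ?_) ?_
      · obtain ⟨x, hx, rfl⟩ := Finset.mem_image.1 hr
        rw [Finset.mem_filter] at hx
        exact Finset.mem_range.2 (hrank_lt x hx.1 b hx.2)
      · rw [Finset.card_image_of_injOn hinj, Finset.card_range]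
    rw [← himage, Finset.filter_image, Finset.card_image_of_injOn
      (hinj.mono (Finset.coe_subset.2 (Finset.filter_subset _ _)))]
    unfold colourCount
    congr 1
    exact Finset.filter_congr fun x hx => hfe x (Finset.mem_filter.1 hx).1 i
  refine ⟨f, fun x hx => by simp [f, hx], fun i => ?_, fun a b i₁ i₂ => ?_⟩
  · obtain ⟨b, hb⟩ : ∃ b, V.filter (fun x => x < b) = V :=
      ⟨V.sup id + 1, Finset.filter_true_of_mem fun x hx =>
        Nat.lt_succ_of_le (Finset.le_sup (f := id) hx)⟩
    have hr : rank b = V.card := by simp only [rank, hb]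
    have := hprefix b i
    rw [hb, hr] at this
    rw [this]
    simp only [he i]
  · rcases le_total b a with hab | hab
    · rw [Finset.filter_false_of_mem (fun x _ => by omega)]
      simp [colourCount]
    · have hsplit : V.filter (fun x => x < b) =
          V.filter (fun x => x < a) ∪ V.filter (fun x => a ≤ x ∧ x < b) := by
        ext x
        simp only [Finset.mem_filter, Finset.mem_union]
        constructor
        · rintro ⟨h1, h2⟩
          rcases lt_or_ge x a with h | h
          · exact Or.inl ⟨h1, h⟩
          · exact Or.inr ⟨h1, h, h2⟩
        · rintro (⟨h1, h2⟩ | ⟨h1, h2, h3⟩)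
          · exact ⟨h1, by omega⟩
          · exact ⟨h1, h3⟩
      have hdisj : Disjoint (V.filter fun x => x < a) (V.filter fun x => a ≤ x ∧ x < b) :=
        Finset.disjoint_filter.2 fun x _ h1 h2 => by omega
      have key : ∀ i, colourCount f (V.filter fun x => x < b) i =
          colourCount f (V.filter fun x => x < a) i +
            colourCount f (V.filter fun x => a ≤ x ∧ x < b) i := fun i => by
        rw [hsplit, colourCount_union hdisj]
      have k₁ := key i₁
      have k₂ := key i₂
      rw [hprefix, hprefix] at k₁ k₂
      split_ifs at k₁ k₂ <;> omega

end Extension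

section Merging

variable {d : ℕ} {η : ℝ}

/-- Colours can be chosen on a set of fewer than `d` elements so that its union with a
balanced set stays balanced: use the rarest admissible colours. -/
lemma exists_balancing_colours (hη0 : 0 < η) (hη : η ≤ 1 / 2) (w : Fin d → ℕ)
    (hw : ∀ i, 0 < w i) (P : Finset (Fin d)) {u : ℕ} (hu : P.card + u < d)
    (hbal : ∀ i₁ i₂, η * (w i₁ : ℝ) ≤ w i₂)
    (hbalP : ∀ i₁ i₂, η * ((w i₁ + if i₁ ∈ P then 1 else 0 : ℕ) : ℝ) ≤
      (w i₂ + if i₂ ∈ P then 1 else 0 : ℕ)) :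
    ∃ Q : Finset (Fin d), Disjoint P Q ∧ Q.card = u ∧
      ∀ i₁ i₂, η * ((w i₁ + if i₁ ∈ P ∪ Q then 1 else 0 : ℕ) : ℝ) ≤
        (w i₂ + if i₂ ∈ P ∪ Q then 1 else 0 : ℕ) := by
  have hK : Pᶜ.card = d - P.card := by rw [Finset.card_compl, Fintype.card_fin]
  obtain ⟨Q, hQP, hQ, hmin⟩ := exists_subset_card_eq_of_minimal w Pᶜ u (by omega)
  refine ⟨Q, Finset.disjoint_left.2 fun i hi hq => Finset.mem_compl.1 (hQP hq) hi, hQ, ?_⟩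
  intro i₁ i₂
  have b := hbal i₁ i₂
  have bP := hbalP i₁ i₂
  have pos : (1 : ℝ) ≤ w i₁ := by exact_mod_cast hw i₁
  by_cases h₂ : i₂ ∈ P ∪ Q
  · rw [if_pos h₂]
    split_ifs <;> push_cast <;> nlinarith
  · rw [if_neg h₂]
    rw [Finset.mem_union, not_or] at h₂
    rw [if_neg h₂.1] at bP
    by_cases h₁ : i₁ ∈ Q
    · have hle := hmin i₁ h₁ i₂ (Finset.mem_compl.2 h₂.1) h₂.2
      have hle' : (w i₁ : ℝ) ≤ w i₂ := by exact_mod_cast hle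
      rw [if_pos (Finset.mem_union_right _ h₁)]
      push_cast
      nlinarith
    · simpa [h₁] using bP

lemma mul_le_of_le_succ (hη : η ≤ 1 / 2) {m a b : ℕ} (hm : 0 < m)
    (ha : a ≤ m + 1) (hb : m ≤ b) : η * (a : ℝ) ≤ b := by
  have h1 : (a : ℝ) ≤ m + 1 := by exact_mod_cast ha
  have h2 : (m : ℝ) ≤ b := by exact_mod_cast hb
  have h3 : (1 : ℝ) ≤ m := by exact_mod_cast hm
  nlinarith

/-- Given the colours `P` of fewer than `d` elements, the surplus colours `T` of an equitable
colouring can be chosen so that the union remains balanced. -/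
lemma exists_surplus_colours (hη : η ≤ 1 / 2) (P : Finset (Fin d)) {m t : ℕ}
    (hm : 0 < m) (ht : t ≤ d) :
    ∃ T : Finset (Fin d), T.card = t ∧
      ∀ i₁ i₂, η * (((if i₁ ∈ P then 1 else 0) + (m + if i₁ ∈ T then 1 else 0) : ℕ) : ℝ) ≤
        ((if i₂ ∈ P then 1 else 0) + (m + if i₂ ∈ T then 1 else 0) : ℕ) := by
  have hK : Pᶜ.card = d - P.card := by rw [Finset.card_compl, Fintype.card_fin]
  rcases le_total t Pᶜ.card with h | h
  · obtain ⟨T, hTP, hT⟩ := Finset.exists_subset_card_eq h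
    refine ⟨T, hT, fun i₁ i₂ => mul_le_of_le_succ hη hm ?_ (by omega)⟩
    have := @hTP i₁
    rw [Finset.mem_compl] at this
    split_ifs <;> first | omega | tauto
  · obtain ⟨T, hPT, -, hT⟩ := Finset.exists_subsuperset_card_eq (n := t)
      (Finset.subset_univ Pᶜ) h (by simpa using ht)
    refine ⟨T, hT, fun i₁ i₂ =>
      mul_le_of_le_succ hη (m := m + 1) (by omega) (by split_ifs <;> omega) ?_⟩
    have := @hPT i₂
    rw [Finset.mem_compl] at this
    split_ifs <;> first | omega | tauto

/-- Two sets with fewer than `d` elements, whose union has more than `d` elements. -/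
lemma exists_extension_of_both_small (hη0 : 0 < η) (hη : η ≤ 1 / 2) (c : ℕ → Fin d)
    {C₁ U₁ C₂ U₂ : Finset ℕ} (hCU₁ : Disjoint C₁ U₁) (hCU₂ : Disjoint C₂ U₂)
    (hdisj : Disjoint (C₁ ∪ U₁) (C₂ ∪ U₂))
    (h₁ : (C₁ ∪ U₁).card < d) (h₂ : (C₂ ∪ U₂).card < d)
    (hlarge : d < (C₁ ∪ U₁ ∪ (C₂ ∪ U₂)).card)
    (hc₁ : GoodOn η c C₁) (hc₂ : GoodOn η c C₂) (hc : GoodOn η c (C₁ ∪ C₂)) :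
    ∃ f : ℕ → Fin d, (∀ x, x ∉ U₁ ∪ U₂ → f x = c x) ∧
      (∀ i, colourCount f (C₁ ∪ U₁) i ≤ 1) ∧ (∀ i, colourCount f (C₂ ∪ U₂) i ≤ 1) ∧
      BalancedOn η f (C₁ ∪ U₁ ∪ (C₂ ∪ U₂)) := by
  have hdC : Disjoint C₁ C₂ :=
    hdisj.mono Finset.subset_union_left Finset.subset_union_left
  rw [Finset.card_union_of_disjoint hdisj] at hlarge
  rw [Finset.card_union_of_disjoint hCU₁] at h₁ hlarge
  rw [Finset.card_union_of_disjoint hCU₂] at h₂ hlarge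
  have o₁ := hc₁.colourCount_le_one (by omega)
  have o₂ := hc₂.colourCount_le_one (by omega)
  have hA : (C₁.image c ∪ C₂.image c)ᶜ.card ≤ U₁.card + U₂.card := by
    rw [← Finset.image_union]
    rcases hc with hc | hc
    · have : (C₁ ∪ C₂).image c = Finset.univ := by
        refine Finset.eq_univ_of_forall fun i => colourCount_pos_iff.1 ?_
        exact hc.2.colourCount_pos hη0 (Finset.card_pos.1 (by omega)) i
      simp [this]
    · rw [Finset.card_compl, Fintype.card_fin, card_image_of_colourCount_le_one hc.2,
        Finset.card_union_of_disjoint hdC]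
      omega
  obtain ⟨Q₁, Q₂, hPQ₁, hPQ₂, hQ₁, hQ₂, hcover⟩ := exists_covering_colours
    (by rw [card_image_of_colourCount_le_one o₁]; omega)
    (by rw [card_image_of_colourCount_le_one o₂]; omega) hA
  obtain ⟨f₁, hf₁, hn₁⟩ := exists_injective_extension c hCU₁ o₁ hPQ₁ hQ₁
  have hf₁C : ∀ x ∈ C₂, f₁ x = c x := fun x hx => hf₁ x fun hU =>
    Finset.disjoint_left.1 hdisj (Finset.mem_union_right _ hU) (Finset.mem_union_left _ hx)
  have himage : C₂.image f₁ = C₂.image c := Finset.image_congr hf₁C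
  obtain ⟨f, hf, hn₂⟩ := exists_injective_extension f₁ hCU₂
    (fun i => by rw [colourCount_congr hf₁C]; exact o₂ i) (by rwa [himage]) hQ₂
  rw [himage] at hn₂
  have hn : ∀ i, colourCount f (C₁ ∪ U₁) i = if i ∈ C₁.image c ∪ Q₁ then 1 else 0 := by
    intro i
    rw [← hn₁ i]
    exact colourCount_congr (fun x hx => hf x fun hU =>
      Finset.disjoint_left.1 hdisj hx (Finset.mem_union_right _ hU)) i
  refine ⟨f, fun x hx => ?_, fun i => ?_, fun i => ?_, fun i₁ i₂ => ?_⟩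
  · rw [Finset.mem_union, not_or] at hx
    rw [hf x hx.2, hf₁ x hx.1]
  · rw [hn]; split_ifs <;> simp
  · rw [hn₂]; split_ifs <;> simp
  · rw [colourCount_union hdisj, colourCount_union hdisj, hn, hn, hn₂, hn₂]
    refine mul_le_of_le_succ hη (m := 1) one_pos (by split_ifs <;> simp) ?_
    rcases hcover i₂ with h | h <;> simp [h]

/-- A set with fewer than `d` elements next to a large set which contains only elements of
the already coloured collection. -/
lemma exists_extension_of_small_of_coloured (hη0 : 0 < η) (hη : η ≤ 1 / 2)
    (c : ℕ → Fin d) {C₁ U₁ C₂ : Finset ℕ} (hCU₁ : Disjoint C₁ U₁)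
    (hdisj : Disjoint (C₁ ∪ U₁) C₂) (h₁ : (C₁ ∪ U₁).card < d) (h₂ : d ≤ C₂.card)
    (hc₁ : GoodOn η c C₁) (hc₂ : GoodOn η c C₂) (hc : GoodOn η c (C₁ ∪ C₂)) :
    ∃ f : ℕ → Fin d, (∀ x, x ∉ U₁ → f x = c x) ∧
      (∀ i, colourCount f (C₁ ∪ U₁) i ≤ 1) ∧ BalancedOn η f (C₁ ∪ U₁ ∪ C₂) := by
  have hdC : Disjoint C₁ C₂ := hdisj.mono_left Finset.subset_union_left
  rw [Finset.card_union_of_disjoint hCU₁] at h₁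
  have o₁ := hc₁.colourCount_le_one (by omega)
  have b₂ := hc₂.balancedOn hη h₂
  have b := hc.balancedOn hη (by rw [Finset.card_union_of_disjoint hdC]; omega)
  obtain ⟨Q, hPQ, hQ, hbal⟩ := exists_balancing_colours hη0 hη (colourCount c C₂)
    (fun i => b₂.colourCount_pos hη0 (Finset.card_pos.1 (by omega)) i) (C₁.image c)
    (u := U₁.card) (by rw [card_image_of_colourCount_le_one o₁]; omega) b₂
    (fun i₁ i₂ => by
      have := b i₁ i₂
      rwa [colourCount_union hdC, colourCount_union hdC, colourCount_eq_ite o₁,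
        colourCount_eq_ite o₁, add_comm, add_comm (ite _ _ _) (colourCount c C₂ i₂)] at this)
  obtain ⟨f, hf, hn⟩ := exists_injective_extension c hCU₁ o₁ hPQ hQ
  have hfC : ∀ x ∈ C₂, f x = c x := fun x hx => hf x fun hU =>
    Finset.disjoint_left.1 hdisj (Finset.mem_union_right _ hU) hx
  refine ⟨f, hf, fun i => by rw [hn]; split_ifs <;> simp, fun i₁ i₂ => ?_⟩
  rw [colourCount_union hdisj, colourCount_union hdisj, hn, hn, colourCount_congr hfC,
    colourCount_congr hfC, add_comm, add_comm (ite _ _ _) (colourCount c C₂ i₂)]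
  exact hbal i₁ i₂

/-- A set with fewer than `d` elements next to a large set which contains no elements of
the already coloured collection. -/
lemma exists_extension_of_small_of_uncoloured (hη : η ≤ 1 / 2) (hd : 0 < d)
    (c : ℕ → Fin d) {C₁ U₁ U₂ : Finset ℕ} (hCU₁ : Disjoint C₁ U₁)
    (hdisj : Disjoint (C₁ ∪ U₁) U₂) (h₁ : (C₁ ∪ U₁).card < d) (h₂ : d ≤ U₂.card)
    (hc₁ : GoodOn η c C₁) :
    ∃ f : ℕ → Fin d, (∀ x, x ∉ U₁ ∪ U₂ → f x = c x) ∧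
      (∀ i, colourCount f (C₁ ∪ U₁) i ≤ 1) ∧
      (∀ a b, GoodOn η f (U₂.filter fun x => a ≤ x ∧ x < b)) ∧
      BalancedOn η f (C₁ ∪ U₁ ∪ U₂) := by
  rw [Finset.card_union_of_disjoint hCU₁] at h₁
  have o₁ := hc₁.colourCount_le_one (by omega)
  obtain ⟨Q, hQP, hQ⟩ := Finset.exists_subset_card_eq
    (s := (C₁.image c)ᶜ) (n := U₁.card) (by
      rw [Finset.card_compl, Fintype.card_fin, card_image_of_colourCount_le_one o₁]
      omega)
  obtain ⟨f₁, hf₁, hn₁⟩ := exists_injective_extension c hCU₁ o₁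
    (Finset.disjoint_left.2 fun i hi hq => Finset.mem_compl.1 (hQP hq) hi) hQ
  obtain ⟨T, hT, hbal⟩ := exists_surplus_colours hη (C₁.image c ∪ Q)
    (Nat.div_pos h₂ hd) (Nat.mod_lt U₂.card hd).le
  obtain ⟨f, hf, hn₂, heq⟩ := exists_cyclic_colouring hd f₁ U₂ hT
  have hn : ∀ i, colourCount f (C₁ ∪ U₁) i = if i ∈ C₁.image c ∪ Q then 1 else 0 := by
    intro i
    rw [← hn₁ i]
    exact colourCount_congr (fun x hx => hf x (Finset.disjoint_left.1 hdisj hx)) i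
  refine ⟨f, fun x hx => ?_, fun i => by rw [hn]; split_ifs <;> simp,
    fun a b => goodOn_of_equitable hη (heq a b), fun i₁ i₂ => ?_⟩
  · rw [Finset.mem_union, not_or] at hx
    rw [hf x hx.2, hf₁ x hx.1]
  · rw [colourCount_union hdisj, colourCount_union hdisj, hn, hn, hn₂, hn₂]
    exact hbal i₁ i₂

end Merging

section Tree

variable {d j : ℕ} {η : ℝ} {H : Finset ℕ} {f g : ℕ → Fin d}

lemma restrict_union (j k m : ℕ) (C U : Finset ℕ) :
    restrict j k m (C ∪ U) = restrict j k m C ∪ restrict j k m U :=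
  Finset.filter_union _ _ _

lemma restrict_subset (j k m : ℕ) (C : Finset ℕ) : restrict j k m C ⊆ C :=
  Finset.filter_subset _ _

lemma disjoint_restrict (j k : ℕ) {m m' : ℕ} (h : m ≠ m') (S T : Finset ℕ) :
    Disjoint (restrict j k m S) (restrict j k m' T) :=
  Finset.disjoint_left.2 fun _ hx hx' =>
    h ((Finset.mem_filter.1 hx).2.symm.trans (Finset.mem_filter.1 hx').2)

/-- The elements in a dyadic subinterval, inside a larger dyadic interval. -/
lemma restrict_restrict {k k' m m' : ℕ} (hk : k ≤ k') (hk' : k' ≤ j)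
    (hm : m' / 2 ^ (k' - k) = m) (S : Finset ℕ) :
    restrict j k' m' (restrict j k m S) = restrict j k' m' S := by
  unfold restrict
  rw [Finset.filter_filter]
  refine Finset.filter_congr fun x _ => ⟨fun h => h.2, fun h => ⟨?_, h⟩⟩
  rw [← hm, ← h, Nat.div_div_eq_div_mul, ← pow_add]
  congr 2
  omega

lemma restrict_subset_restrict {k k' m m' : ℕ} (hk : k ≤ k') (hk' : k' ≤ j)
    (hm : m' / 2 ^ (k' - k) = m) (S : Finset ℕ) :
    restrict j k' m' S ⊆ restrict j k m S := by
  rw [← restrict_restrict hk hk' hm S]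
  exact restrict_subset _ _ _ _

lemma restrict_eq_interval (j k m : ℕ) (S : Finset ℕ) :
    restrict j k m S =
      S.filter fun x => m * 2 ^ (j - k) ≤ x ∧ x < (m + 1) * 2 ^ (j - k) :=
  Finset.filter_congr fun x _ => by
    rw [le_antisymm_iff, and_comm, Nat.le_div_iff_mul_le (by positivity), ← Nat.lt_add_one_iff (m := x / _),
      Nat.div_lt_iff_lt_mul (by positivity)]

lemma restrict_eq_union_children {k m m₁ m₂ : ℕ} (hk : k < j)
    (hm : (m₁ = 2 * m ∧ m₂ = 2 * m + 1) ∨ (m₁ = 2 * m + 1 ∧ m₂ = 2 * m)) (S : Finset ℕ) :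
    restrict j k m S = restrict j (k + 1) m₁ S ∪ restrict j (k + 1) m₂ S := by
  unfold restrict
  rw [← Finset.filter_or]
  refine Finset.filter_congr fun x _ => ?_
  have : x / 2 ^ (j - k) = x / 2 ^ (j - (k + 1)) / 2 := by
    rw [Nat.div_div_eq_div_mul, ← pow_succ]
    congr 2
    omega
  rw [this]
  omega

lemma GoodBelow.congr {k m : ℕ} (hf : GoodBelow j η H f k m)
    (h : ∀ x ∈ restrict j k m H, f x = g x) : GoodBelow j η H g k m :=
  fun k' hk hk' m' hm => (hf k' hk hk' m' hm).congr fun x hx =>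
    h x (restrict_subset_restrict hk hk' hm H hx)

lemma goodBelow_of_colourCount_le_one {k m : ℕ} (hcard : (restrict j k m H).card ≤ d)
    (h : ∀ i, colourCount f (restrict j k m H) i ≤ 1) : GoodBelow j η H f k m :=
  fun _ hk hk' _ hm =>
    have hsub := restrict_subset_restrict hk hk' hm H
    Or.inr ⟨(Finset.card_le_card hsub).trans hcard,
      fun i => (colourCount_mono hsub i).trans (h i)⟩

lemma goodBelow_of_children {k m m₁ m₂ : ℕ}
    (hm : (m₁ = 2 * m ∧ m₂ = 2 * m + 1) ∨ (m₁ = 2 * m + 1 ∧ m₂ = 2 * m))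
    (h : GoodOn η f (restrict j k m H)) (h₁ : GoodBelow j η H f (k + 1) m₁)
    (h₂ : GoodBelow j η H f (k + 1) m₂) : GoodBelow j η H f k m := by
  intro k' hk hk' m' hm'
  rcases hk.eq_or_lt with rfl | hlt
  · rw [Nat.sub_self, pow_zero, Nat.div_one] at hm'
    rwa [hm']
  · have : m = m' / 2 ^ (k' - (k + 1)) / 2 := by
      rw [← hm', Nat.div_div_eq_div_mul, ← pow_succ]
      congr 2
      omega
    by_cases hc : m' / 2 ^ (k' - (k + 1)) = m₁
    · exact h₁ k' hlt hk' m' hc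
    · exact h₂ k' hlt hk' m' (by omega)

/-- A node with a large number of elements one of whose children is small while the other
one is large. -/
lemma exists_goodBelow_of_small_of_large (hd : 0 < d) (hη0 : 0 < η) (hη : η ≤ 1 / 2)
    {C U : Finset ℕ} (hCU : Disjoint C U) {c : ℕ → Fin d}
    (hc : ∀ k ≤ j, ∀ m < 2 ^ k, GoodOn η c (restrict j k m C))
    {k m m₁ m₂ : ℕ} (hk : k < j) (hmk : m < 2 ^ k)
    (hm : (m₁ = 2 * m ∧ m₂ = 2 * m + 1) ∨ (m₁ = 2 * m + 1 ∧ m₂ = 2 * m))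
    (hlarge : d < (restrict j k m (C ∪ U)).card)
    (h₁ : (restrict j (k + 1) m₁ (C ∪ U)).card < d)
    (h₂ : d ≤ (restrict j (k + 1) m₂ (C ∪ U)).card)
    (hempty : restrict j (k + 1) m₂ U = ∅ ∨ restrict j (k + 1) m₂ C = ∅) :
    ∃ f : ℕ → Fin d, (∀ x ∈ C, f x = c x) ∧ GoodBelow j η (C ∪ U) f k m := by
  have hne : m₁ ≠ m₂ := by omega
  have hpow : 2 ^ (k + 1) = 2 * 2 ^ k := pow_succ' 2 k
  have hsub : ∀ k m, restrict j k m U ⊆ U := fun k m => restrict_subset j k m U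
  have hdis : ∀ k m, Disjoint (restrict j k m C) (restrict j k m U) := fun k m =>
    hCU.mono (restrict_subset j k m C) (hsub k m)
  have hC : ∀ x ∈ C, x ∉ U := fun _ hx => Finset.disjoint_left.1 hCU hx
  have hd12 : Disjoint (restrict j (k + 1) m₁ (C ∪ U)) (restrict j (k + 1) m₂ (C ∪ U)) :=
    disjoint_restrict j (k + 1) hne _ _
  have hc₁ := hc (k + 1) hk m₁ (by omega)
  have hunion := restrict_eq_union_children hk hm (C ∪ U)
  rcases hempty with hU₂ | hC₂
  · have e₂ : restrict j (k + 1) m₂ (C ∪ U) = restrict j (k + 1) m₂ C := by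
      rw [restrict_union, hU₂, Finset.union_empty]
    have e₁ := restrict_union j (k + 1) m₁ C U
    rw [e₂] at h₂ hd12 hunion
    obtain ⟨f, hf, hone, hbal⟩ := exists_extension_of_small_of_coloured hη0 hη c
      (hdis (k + 1) m₁) (by rwa [← e₁]) (by rwa [← e₁]) h₂ hc₁ (hc (k + 1) hk m₂ (by omega))
      (by rw [← restrict_eq_union_children hk hm]; exact hc k hk.le m hmk)
    have hfC : ∀ x ∈ C, f x = c x := fun x hx => hf x fun h => hC x hx (hsub _ _ h)
    refine ⟨f, hfC, goodBelow_of_children hm (Or.inl ⟨hlarge, ?_⟩)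
      (goodBelow_of_colourCount_le_one h₁.le (by rwa [e₁])) fun k' hk₁ hk' m' hm' => ?_⟩
    · rwa [hunion, e₁]
    · have hm'k : m' < 2 ^ k' := by
        have h3 : m' / 2 ^ (k' - (k + 1)) < 2 ^ (k + 1) := by omega
        rw [Nat.div_lt_iff_lt_mul (by positivity), ← pow_add] at h3
        rwa [Nat.add_sub_cancel' hk₁] at h3
      rw [← restrict_restrict hk₁ hk' hm', e₂, restrict_restrict hk₁ hk' hm']
      exact (hc k' hk' m' hm'k).congr fun x hx => (hfC x (restrict_subset _ _ _ _ hx)).symm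
  · have e₂ : restrict j (k + 1) m₂ (C ∪ U) = restrict j (k + 1) m₂ U := by
      rw [restrict_union, hC₂, Finset.empty_union]
    have e₁ := restrict_union j (k + 1) m₁ C U
    rw [e₂] at h₂ hd12 hunion
    obtain ⟨f, hf, hone, hint, hbal⟩ := exists_extension_of_small_of_uncoloured hη hd c
      (hdis (k + 1) m₁) (by rwa [← e₁]) (by rwa [← e₁]) h₂ hc₁
    refine ⟨f, fun x hx => hf x fun h => hC x hx ?_,
      goodBelow_of_children hm (Or.inl ⟨hlarge, ?_⟩)
      (goodBelow_of_colourCount_le_one h₁.le (by rwa [e₁])) fun k' hk₁ hk' m' hm' => ?_⟩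
    · exact Finset.union_subset (hsub _ _) (hsub _ _) h
    · rwa [hunion, e₁]
    · rw [← restrict_restrict hk₁ hk' hm', e₂, restrict_eq_interval j k' m']
      exact hint _ _

lemma exists_goodBelow (hd : 0 < d) (hη0 : 0 < η) (hη : η ≤ 1 / 2)
    {C U : Finset ℕ} (hCU : Disjoint C U) {c : ℕ → Fin d}
    (hc : ∀ k ≤ j, ∀ m < 2 ^ k, GoodOn η c (restrict j k m C))
    (hprev : Previsible j d C U) (t : ℕ) :
    ∀ k m, k + t = j → m < 2 ^ k →
      ∃ f : ℕ → Fin d, (∀ x ∈ C, f x = c x) ∧ GoodBelow j η (C ∪ U) f k m := by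
  have hsub : ∀ k m, restrict j k m U ⊆ U := fun k m => restrict_subset j k m U
  have hdis : ∀ k m, Disjoint (restrict j k m C) (restrict j k m U) := fun k m =>
    hCU.mono (restrict_subset j k m C) (hsub k m)
  have hC : ∀ x ∈ C, x ∉ U := fun _ hx => Finset.disjoint_left.1 hCU hx
  have hsmall : ∀ k ≤ j, ∀ m < 2 ^ k, (restrict j k m (C ∪ U)).card ≤ d →
      ∃ f : ℕ → Fin d, (∀ x ∈ C, f x = c x) ∧ GoodBelow j η (C ∪ U) f k m := by
    intro k hk m hm hcard
    have e := restrict_union j k m C U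
    have hcard' := hcard
    rw [e, Finset.card_union_of_disjoint (hdis k m)] at hcard'
    have o := (hc k hk m hm).colourCount_le_one (by omega)
    obtain ⟨Q, hQP, hQ⟩ := Finset.exists_subset_card_eq
      (s := ((restrict j k m C).image c)ᶜ) (n := (restrict j k m U).card) (by
        rw [Finset.card_compl, Fintype.card_fin, card_image_of_colourCount_le_one o]
        omega)
    obtain ⟨f, hf, hn⟩ := exists_injective_extension c (hdis k m) o
      (Finset.disjoint_left.2 fun i hi hq => Finset.mem_compl.1 (hQP hq) hi) hQ
    refine ⟨f, fun x hx => hf x fun h => hC x hx (hsub _ _ h),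
      goodBelow_of_colourCount_le_one hcard fun i => ?_⟩
    rw [e, hn]
    split_ifs <;> simp
  induction t with
  | zero =>
    intro k m hk hm
    refine hsmall k (by omega) m hm (le_trans (Finset.card_le_one.2 fun x hx y hy => ?_) hd)
    have hx := (Finset.mem_filter.1 hx).2
    have hy := (Finset.mem_filter.1 hy).2
    have hk0 : j - k = 0 := by omega
    rw [hk0, pow_zero, Nat.div_one] at hx hy
    exact hx.trans hy.symm
  | succ t ih =>
    intro k m hkt hm
    have hk : k < j := by omega
    have hpow : 2 ^ (k + 1) = 2 * 2 ^ k := pow_succ' 2 k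
    rcases le_or_gt (restrict j k m (C ∪ U)).card d with hcard | hlarge
    · exact hsmall k hk.le m hm hcard
    have hch : (2 * m = 2 * m ∧ 2 * m + 1 = 2 * m + 1) ∨
        (2 * m = 2 * m + 1 ∧ 2 * m + 1 = 2 * m) := Or.inl ⟨rfl, rfl⟩
    have hch' : (2 * m + 1 = 2 * m ∧ 2 * m = 2 * m + 1) ∨
        (2 * m + 1 = 2 * m + 1 ∧ 2 * m = 2 * m) := Or.inr ⟨rfl, rfl⟩
    have hd12 : Disjoint (restrict j (k + 1) (2 * m) (C ∪ U))
        (restrict j (k + 1) (2 * m + 1) (C ∪ U)) :=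
      disjoint_restrict j (k + 1) (by omega) _ _
    have hunion := restrict_eq_union_children hk hch (C ∪ U)
    rcases lt_or_ge (restrict j (k + 1) (2 * m) (C ∪ U)).card d with h₁ | h₁ <;>
      rcases lt_or_ge (restrict j (k + 1) (2 * m + 1) (C ∪ U)).card d with h₂ | h₂
    · have e₁ := restrict_union j (k + 1) (2 * m) C U
      have e₂ := restrict_union j (k + 1) (2 * m + 1) C U
      obtain ⟨f, hf, n₁, n₂, hbal⟩ := exists_extension_of_both_small hη0 hη c
        (hdis (k + 1) (2 * m)) (hdis (k + 1) (2 * m + 1)) (by rwa [← e₁, ← e₂])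
        (by rwa [← e₁]) (by rwa [← e₂]) (by rwa [← e₁, ← e₂, ← hunion])
        (hc (k + 1) hk _ (by omega)) (hc (k + 1) hk _ (by omega))
        (by rw [← restrict_eq_union_children hk hch]; exact hc k hk.le m hm)
      refine ⟨f, fun x hx => hf x fun h => hC x hx
          (Finset.union_subset (hsub _ _) (hsub _ _) h),
        goodBelow_of_children hch (Or.inl ⟨hlarge, ?_⟩)
          (goodBelow_of_colourCount_le_one h₁.le (by rwa [e₁]))
          (goodBelow_of_colourCount_le_one h₂.le (by rwa [e₂]))⟩
      rwa [hunion, e₁, e₂]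
    · exact exists_goodBelow_of_small_of_large hd hη0 hη hCU hc hk hm hch hlarge h₁ h₂
        (hprev k hk m hm _ _ hch h₁ h₂)
    · exact exists_goodBelow_of_small_of_large hd hη0 hη hCU hc hk hm hch' hlarge h₂ h₁
        (hprev k hk m hm _ _ hch' h₂ h₁)
    · obtain ⟨f₁, hf₁, g₁⟩ := ih (k + 1) (2 * m) (by omega) (by omega)
      obtain ⟨f₂, hf₂, g₂⟩ := ih (k + 1) (2 * m + 1) (by omega) (by omega)
      let f : ℕ → Fin d := fun x =>
        if x ∈ restrict j (k + 1) (2 * m) (C ∪ U) then f₁ x else f₂ x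
      have k₁ : GoodBelow j η (C ∪ U) f (k + 1) (2 * m) :=
        g₁.congr fun x hx => by simp [f, hx]
      have k₂ : GoodBelow j η (C ∪ U) f (k + 1) (2 * m + 1) :=
        g₂.congr fun x hx => by simp [f, Finset.disjoint_right.1 hd12 hx]
      have b₁ := (k₁ (k + 1) le_rfl hk (2 * m) (by simp)).balancedOn hη h₁
      have b₂ := (k₂ (k + 1) le_rfl hk (2 * m + 1) (by simp)).balancedOn hη h₂
      refine ⟨f, fun x hx => ?_, goodBelow_of_children hch (Or.inl ⟨hlarge, ?_⟩) k₁ k₂⟩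
      · simp only [f]
        split_ifs
        · exact hf₁ x hx
        · exact hf₂ x hx
      · rw [hunion]
        exact b₁.union b₂ hd12

end Tree

lemma card_restrict_filter {d : ℕ} (j k m : ℕ) (S : Finset ℕ) (f : ℕ → Fin d) (i : Fin d) :
    (restrict j k m (S.filter fun x => f x = i)).card = colourCount f (restrict j k m S) i := by
  unfold restrict colourCount
  rw [Finset.filter_comm]

/-- The classes of a colouring are the fibres of a function. -/
lemma IsColouring.exists_eq_filter {d : ℕ} (hd : 0 < d) {C : Finset ℕ}
    {col : Fin d → Finset ℕ} (h : IsColouring d C col) :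
    ∃ c : ℕ → Fin d, ∀ i, col i = C.filter fun x => c x = i := by
  obtain ⟨hsub, hdisj, hcover⟩ := h
  have : ∀ x, ∃ i : Fin d, x ∈ C → x ∈ col i := fun x => by
    by_cases hx : x ∈ C
    · obtain ⟨i, hi⟩ := hcover x hx
      exact ⟨i, fun _ => hi⟩
    · exact ⟨⟨0, hd⟩, fun h => absurd h hx⟩
  choose c hc using this
  refine ⟨c, fun i => Finset.ext fun x => ?_⟩
  rw [Finset.mem_filter]
  constructor
  · intro hx
    refine ⟨hsub i hx, ?_⟩
    by_contra hne
    exact Finset.disjoint_left.1 (hdisj _ _ hne) (hc x (hsub i hx)) hx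
  · rintro ⟨hx, rfl⟩
    exact hc x hx

/-- The fibres of a function form a colouring. -/
lemma isColouring_filter {d : ℕ} (S : Finset ℕ) (f : ℕ → Fin d) :
    IsColouring d S fun i => S.filter fun x => f x = i :=
  ⟨fun _ => Finset.filter_subset _ _,
    fun _ _ h => Finset.disjoint_filter.2 fun _ _ h₁ h₂ => h (h₁.symm.trans h₂),
    fun x hx => ⟨f x, Finset.mem_filter.2 ⟨hx, rfl⟩⟩⟩

/-- **Theorem (consistent colouring of previsible pairs).**
Fix `d ∈ ℕ` and `0 < η ≤ 1/2`.  Let `C ⊆ D_j` with a fixed `(η, d)`-homogeneous colouring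
`{C_i : 1 ≤ i ≤ d}`, and let `U ⊆ D_j` be disjoint from `C` such that the pair `(C, U)` is
`d`-previsible.  Then there is a decomposition `U = U_1 ∪ … ∪ U_d` such that
`{H_i = C_i ∪ U_i : 1 ≤ i ≤ d}` is an `(η, d)`-homogeneous colouring of `H = C ∪ U`. -/
theorem consistent_colouring_of_previsible
    (j d : ℕ) (hd : 0 < d) (η : ℝ) (hη0 : 0 < η) (hη : η ≤ 1 / 2)
    (C U : Finset ℕ) (hC : ∀ x ∈ C, x < 2 ^ j) (hU : ∀ x ∈ U, x < 2 ^ j)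
    (hCU : Disjoint C U)
    (colC : Fin d → Finset ℕ) (hcolC : IsHomogeneous j d η C colC)
    (hprev : Previsible j d C U) :
    ∃ colU : Fin d → Finset ℕ, IsColouring d U colU ∧
      IsHomogeneous j d η (C ∪ U) (fun i => colC i ∪ colU i) := by
  obtain ⟨c, hc⟩ := hcolC.1.exists_eq_filter hd
  have hgood : ∀ k ≤ j, ∀ m < 2 ^ k, GoodOn η c (restrict j k m C) := fun k hk m hm => by
    simpa only [GoodOn, BalancedOn, hc, card_restrict_filter] using hcolC.2 k hk m hm
  obtain ⟨f, hf, hbelow⟩ :=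
    exists_goodBelow hd hη0 hη hCU hgood hprev j 0 0 (by omega) (by simp)
  have hunion : (fun i => colC i ∪ U.filter fun x => f x = i) =
      fun i => (C ∪ U).filter fun x => f x = i := by
    funext i
    rw [Finset.filter_union, hc]
    congr 1
    exact Finset.filter_congr fun x hx => by rw [hf x hx]
  refine ⟨fun i => U.filter fun x => f x = i, isColouring_filter U f, ?_⟩
  rw [hunion]
  refine ⟨isColouring_filter _ f, fun k hk m hm => ?_⟩
  simp only [card_restrict_filter]
  exact hbelow k (Nat.zero_le k) hk m (Nat.div_eq_of_lt (by simpa using hm))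
end

section
/- Let 1 ≤ k ≤ n. Suppose {C_1(k), …, C_d(k)} is a (1/n, d)-homogeneous colouring of C(k) such that C_i(0) ⊆ C_i(k) for all 1 ≤ i ≤ d, where C_1(0) = {J_{n+1}} and C_i(0) = {I_{i-1}} for 2 ≤ i ≤ d. Then necessarily J_{n-k+1} ∈ C_1(k), i.e. J_{n-k+1} must have colour 1. -/
/- Setup for the counterexample of Section 3 (with `d = 2 ^ a`, `η = 1 / n`,
`j ≥ n + a + 1`): a chain of dyadic intervals `L_1 ⊂ L_2 ⊂ … ⊂ L_{n+2}` with
`L_i ∈ D_{j-a-i+1}` (so `L i` is the position of `L_i` at scale `j + 1 - (a + i)`, and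
`L_i ⊂ L_{i+1}` reads `L (i+1) = L i / 2`); `P_i = L_{i+1} \ L_i` is the dyadic brother
of `L_i` in `L_{i+1}` (same scale as `L_i`, same parent, different position); pairwise
distinct `I_1, …, I_{d-1} ∈ D_j` with `I_i ⊆ L_1` (i.e. `I i / 2 ^ a = L 1`), and
`J_1, …, J_{n+1} ∈ D_j` with `J_i ⊆ P_i` (i.e. `J i / 2 ^ (a + i - 1) = P i`).
For `0 ≤ k ≤ n`, `C(k) = {I_1, …, I_{d-1}} ∪ {J_{n-k+1}, …, J_{n+1}}` is encoded as
`(Finset.Icc 1 (2 ^ a - 1)).image I ∪ (Finset.Icc (n + 1 - k) (n + 1)).image J`.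
Colour classes are indexed by `i : Fin (2 ^ a)`, index `i` corresponding to colour
`i.val + 1 ∈ {1, …, d}`. -/

/-- In a chain of dyadic intervals with positions `L (i + 1) = L i / 2`, an interval contained
in `L p` is contained in every later `L q`. -/
theorem div_two_pow_eq_of_chain {N c x p q : ℕ} {L : ℕ → ℕ}
    (hchain : ∀ i, 1 ≤ i → i ≤ N → L (i + 1) = L i / 2)
    (hp : 1 ≤ p) (hpq : p ≤ q) (hq : q ≤ N + 1) (hx : x / 2 ^ (c + p) = L p) :
    x / 2 ^ (c + q) = L q := by
  induction q, hpq using Nat.le_induction with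
  | base => exact hx
  | succ r hpr ih =>
    rw [hchain r (by omega) (by omega), ← ih (by omega), Nat.div_div_eq_div_mul, ← pow_succ,
      add_assoc]

/-- **The basic observation: `J_{n-k+1}` must have colour 1.**
Let `1 ≤ k ≤ n` and suppose `{C_1(k), …, C_d(k)}` is a `(1/n, d)`-homogeneous colouring
of `C(k)` such that `C_i(0) ⊆ C_i(k)` for all `1 ≤ i ≤ d`, where `C_1(0) = {J_{n+1}}` and
`C_i(0) = {I_{i-1}}` for `2 ≤ i ≤ d`.  Then necessarily `J_{n-k+1} ∈ C_1(k)`. -/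
theorem basic_observation_colour_one
    (a n j : ℕ) (hn : 1 ≤ n) (hj : n + a + 1 ≤ j)
    (L P I J : ℕ → ℕ)
    (hL : ∀ i, 1 ≤ i → i ≤ n + 2 → L i < 2 ^ (j + 1 - (a + i)))
    (hchain : ∀ i, 1 ≤ i → i ≤ n + 1 → L (i + 1) = L i / 2)
    (hP : ∀ i, 1 ≤ i → i ≤ n + 1 → P i / 2 = L i / 2 ∧ P i ≠ L i)
    (hI : ∀ i, 1 ≤ i → i ≤ 2 ^ a - 1 → I i < 2 ^ j ∧ I i / 2 ^ a = L 1)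
    (hInj : ∀ i₁ i₂, 1 ≤ i₁ → i₁ ≤ 2 ^ a - 1 → 1 ≤ i₂ → i₂ ≤ 2 ^ a - 1 →
      I i₁ = I i₂ → i₁ = i₂)
    (hJ : ∀ i, 1 ≤ i → i ≤ n + 1 → J i < 2 ^ j ∧ J i / 2 ^ (a + i - 1) = P i)
    (k : ℕ) (hk1 : 1 ≤ k) (hkn : k ≤ n)
    (col : Fin (2 ^ a) → Finset ℕ)
    (hcol : IsHomogeneous j (2 ^ a) (1 / (n : ℝ))
      ((Finset.Icc 1 (2 ^ a - 1)).image I ∪ (Finset.Icc (n + 1 - k) (n + 1)).image J)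
      col)
    (h0 : J (n + 1) ∈ col ⟨0, by positivity⟩)
    (hi : ∀ i : Fin (2 ^ a), 1 ≤ i.val → I i.val ∈ col i) :
    J (n + 1 - k) ∈ col ⟨0, by positivity⟩ := by
  obtain ⟨⟨-, -, hcover⟩, hhom⟩ := hcol
  obtain ⟨m, hm⟩ : ∃ m, m = n + 1 - k := ⟨_, rfl⟩
  rw [← hm] at hcover hhom ⊢
  have hpow : 1 ≤ 2 ^ a := Nat.one_le_two_pow
  have hIL : ∀ i q, 1 ≤ i → i ≤ 2 ^ a - 1 → q ≤ n + 1 → I i / 2 ^ (a + q) = L (q + 1) := by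
    intro i q h1 h2 hq
    rcases Nat.eq_zero_or_pos q with rfl | hq0
    · exact (hI i h1 h2).2
    have hI2 : I i / 2 ^ (a + 1) = L 2 := by
      rw [hchain 1 le_rfl (by omega), ← (hI i h1 h2).2, Nat.div_div_eq_div_mul, ← pow_succ]
    exact div_two_pow_eq_of_chain (L := fun r => L (r + 1)) (N := n)
      (fun r _ hr => hchain (r + 1) (by omega) (by omega)) le_rfl hq0 hq hI2
  have hJL : J m / 2 ^ (a + m) = L (m + 1) := by
    rw [hchain m (by omega) (by omega), ← (hP m (by omega) (by omega)).1,
      ← (hJ m (by omega) (by omega)).2, Nat.div_div_eq_div_mul, ← pow_succ,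
      show a + m - 1 + 1 = a + m by omega]
  have hJout : ∀ i, m < i → i ≤ n + 1 → J i / 2 ^ (a + m) ≠ L (m + 1) := by
    intro i hmi hin h
    refine (hP i (by omega) hin).2 ?_
    rw [← (hJ i (by omega) hin).2]
    obtain ⟨r, rfl⟩ : ∃ r, i = r + 1 := ⟨i - 1, by omega⟩
    exact div_two_pow_eq_of_chain (L := fun r => L (r + 1)) (N := n)
      (fun r _ hr => hchain (r + 1) (by omega) (by omega)) (by omega) (Nat.le_of_lt_succ hmi)
      (by omega) h
  have hscale : j - (j - (a + m)) = a + m := by omega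
  have hLm : L (m + 1) < 2 ^ (j - (a + m)) := by
    have h := hL (m + 1) (by omega) (by omega)
    rwa [show j + 1 - (a + (m + 1)) = j - (a + m) by omega] at h
  have hcard : (restrict j (j - (a + m)) (L (m + 1))
      ((Finset.Icc 1 (2 ^ a - 1)).image I ∪ (Finset.Icc m (n + 1)).image J)).card ≤ 2 ^ a := by
    have hsub : restrict j (j - (a + m)) (L (m + 1))
        ((Finset.Icc 1 (2 ^ a - 1)).image I ∪ (Finset.Icc m (n + 1)).image J) ⊆
        insert (J m) ((Finset.Icc 1 (2 ^ a - 1)).image I) := by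
      intro x hx
      rw [restrict, Finset.mem_filter, hscale, Finset.mem_union] at hx
      obtain ⟨hx | hx, hxL⟩ := hx
      · exact Finset.mem_insert_of_mem hx
      · obtain ⟨i, hiI, rfl⟩ := Finset.mem_image.1 hx
        rw [Finset.mem_Icc] at hiI
        rcases hiI.1.eq_or_lt with rfl | hlt
        · exact Finset.mem_insert_self _ _
        · exact absurd hxL (hJout i hlt hiI.2)
    have h1 := Finset.card_le_card hsub
    have h2 := Finset.card_insert_le (J m) ((Finset.Icc 1 (2 ^ a - 1)).image I)
    have h3 : ((Finset.Icc 1 (2 ^ a - 1)).image I).card ≤ _ := Finset.card_image_le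
    rw [Nat.card_Icc] at h3
    omega
  obtain ⟨c, hc⟩ := hcover (J m) (Finset.mem_union_right _
    (Finset.mem_image_of_mem J (Finset.mem_Icc.2 ⟨le_rfl, by omega⟩)))
  rcases Nat.eq_zero_or_pos c.val with h | hcpos
  · rwa [show (⟨0, by positivity⟩ : Fin (2 ^ a)) = c from Fin.ext h.symm]
  exfalso
  have hcle : c.val ≤ 2 ^ a - 1 := Nat.le_sub_one_of_lt c.isLt
  rcases hhom (j - (a + m)) (Nat.sub_le _ _) (L (m + 1)) hLm with ⟨hlt, -⟩ | ⟨-, hone⟩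
  · omega
  have hmemJ : J m ∈ restrict j (j - (a + m)) (L (m + 1)) (col c) := by
    rw [restrict, Finset.mem_filter, hscale]
    exact ⟨hc, hJL⟩
  have hmemI : I c.val ∈ restrict j (j - (a + m)) (L (m + 1)) (col c) := by
    rw [restrict, Finset.mem_filter, hscale]
    exact ⟨hi c hcpos, hIL c.val m hcpos hcle (by omega)⟩
  have heq : J m = I c.val := Finset.card_le_one.1 (hone c) _ hmemJ _ hmemI
  refine (hP m (by omega) (by omega)).2 ?_
  obtain ⟨r, rfl⟩ : ∃ r, m = r + 1 := ⟨m - 1, by omega⟩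
  rw [← (hJ (r + 1) (by omega) (by omega)).2, heq]
  exact hIL c.val r hcpos hcle (by omega)
end

section
/- For every 0 ≤ k ≤ n-1, the decomposition of C(k) given by C_1(k) = {J_{n-k+1}, …, J_{n+1}} and C_i(k) = {I_{i-1}} for 2 ≤ i ≤ d is a (1/n, d)-homogeneous colouring of C(k). -/
/- Setup for the counterexample of Section 3 (with `d = 2 ^ a`, `η = 1 / n`,
`j ≥ n + a + 1`): a chain of dyadic intervals `L_1 ⊂ L_2 ⊂ … ⊂ L_{n+2}` with
`L_i ∈ D_{j-a-i+1}` (so `L i` is the position of `L_i` at scale `j + 1 - (a + i)`, and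
`L_i ⊂ L_{i+1}` reads `L (i+1) = L i / 2`); `P_i = L_{i+1} \ L_i` is the dyadic brother
of `L_i` in `L_{i+1}` (same scale as `L_i`, same parent, different position); pairwise
distinct `I_1, …, I_{d-1} ∈ D_j` with `I_i ⊆ L_1` (i.e. `I i / 2 ^ a = L 1`), and
`J_1, …, J_{n+1} ∈ D_j` with `J_i ⊆ P_i` (i.e. `J i / 2 ^ (a + i - 1) = P i`).
For `0 ≤ k ≤ n`, `C(k) = {I_1, …, I_{d-1}} ∪ {J_{n-k+1}, …, J_{n+1}}` is encoded as
`(Finset.Icc 1 (2 ^ a - 1)).image I ∪ (Finset.Icc (n + 1 - k) (n + 1)).image J`.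
Colour classes are indexed by `i : Fin (2 ^ a)`, index `i` corresponding to colour
`i.val + 1 ∈ {1, …, d}`. -/

theorem div_two_pow_eq_of_le {x y s t : ℕ} (hst : s ≤ t) (h : x / 2 ^ s = y / 2 ^ s) :
    x / 2 ^ t = y / 2 ^ t := by
  obtain ⟨u, rfl⟩ := Nat.exists_eq_add_of_le hst
  rw [pow_add, ← Nat.div_div_eq_div_mul, ← Nat.div_div_eq_div_mul, h]

theorem chain_eq_div_two_pow {N : ℕ} {L : ℕ → ℕ}
    (hchain : ∀ i, 1 ≤ i → i ≤ N → L (i + 1) = L i / 2) {p : ℕ} (hp : 1 ≤ p) :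
    ∀ t, p + t ≤ N + 1 → L (p + t) = L p / 2 ^ t
  | 0, _ => by simp
  | t + 1, ht => by
    rw [← add_assoc, hchain (p + t) (by omega) (by omega),
      chain_eq_div_two_pow hchain hp t (by omega), Nat.div_div_eq_div_mul, pow_succ]

/-- A point of `L_p` lies in every later member of the chain. -/
theorem div_two_pow_eq_chain {a N : ℕ} {L : ℕ → ℕ}
    (hchain : ∀ i, 1 ≤ i → i ≤ N → L (i + 1) = L i / 2) {x p q : ℕ} (hp : 1 ≤ p)
    (hpq : p ≤ q) (hq : q ≤ N + 1) (hx : x / 2 ^ (a + p - 1) = L p) :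
    x / 2 ^ (a + q - 1) = L q := by
  obtain ⟨t, rfl⟩ := Nat.exists_eq_add_of_le hpq
  rw [chain_eq_div_two_pow hchain hp t hq, ← hx, Nat.div_div_eq_div_mul, ← pow_add]
  congr 2
  omega

/-- A point of the brother of `L_i` lies in `L_{i+1}`. -/
theorem div_two_pow_eq_succ_of_brother {a i x l l' p : ℕ} (hi : 1 ≤ i) (hl : l' = l / 2)
    (hp : p / 2 = l / 2) (hx : x / 2 ^ (a + i - 1) = p) :
    x / 2 ^ (a + (i + 1) - 1) = l' := by
  rw [hl, ← hp, ← hx, Nat.div_div_eq_div_mul, ← pow_succ]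
  congr 2
  omega

/-- **Stage `k`, `0 ≤ k ≤ n - 1`: the canonical colouring of `C(k)` is homogeneous.**
The decomposition of `C(k)` given by `C_1(k) = {J_{n-k+1}, …, J_{n+1}}` and
`C_i(k) = {I_{i-1}}` for `2 ≤ i ≤ d` is a `(1/n, d)`-homogeneous colouring of `C(k)`. -/
theorem canonical_colouring_homogeneous
    (a n j : ℕ) (hn : 1 ≤ n) (hj : n + a + 1 ≤ j)
    (L P I J : ℕ → ℕ)
    (hL : ∀ i, 1 ≤ i → i ≤ n + 2 → L i < 2 ^ (j + 1 - (a + i)))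
    (hchain : ∀ i, 1 ≤ i → i ≤ n + 1 → L (i + 1) = L i / 2)
    (hP : ∀ i, 1 ≤ i → i ≤ n + 1 → P i / 2 = L i / 2 ∧ P i ≠ L i)
    (hI : ∀ i, 1 ≤ i → i ≤ 2 ^ a - 1 → I i < 2 ^ j ∧ I i / 2 ^ a = L 1)
    (hInj : ∀ i₁ i₂, 1 ≤ i₁ → i₁ ≤ 2 ^ a - 1 → 1 ≤ i₂ → i₂ ≤ 2 ^ a - 1 →
      I i₁ = I i₂ → i₁ = i₂)
    (hJ : ∀ i, 1 ≤ i → i ≤ n + 1 → J i < 2 ^ j ∧ J i / 2 ^ (a + i - 1) = P i)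
    (k : ℕ) (hk : k ≤ n - 1) :
    IsHomogeneous j (2 ^ a) (1 / (n : ℝ))
      ((Finset.Icc 1 (2 ^ a - 1)).image I ∪ (Finset.Icc (n + 1 - k) (n + 1)).image J)
      (fun i : Fin (2 ^ a) =>
        if i.val = 0 then (Finset.Icc (n + 1 - k) (n + 1)).image J else {I i.val}) := by
  have hIL : ∀ l q, 1 ≤ l → l ≤ 2 ^ a - 1 → 1 ≤ q → q ≤ n + 2 →
      I l / 2 ^ (a + q - 1) = L q := fun l q h1 h2 h3 h4 =>
    div_two_pow_eq_chain hchain le_rfl h3 h4 (by simpa using (hI l h1 h2).2)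
  have hJL : ∀ i q, 1 ≤ i → i < q → q ≤ n + 2 → J i / 2 ^ (a + q - 1) = L q :=
    fun i q h1 h2 h3 => div_two_pow_eq_chain hchain (by omega) h2 h3
      (div_two_pow_eq_succ_of_brother h1 (hchain i h1 (by omega)) (hP i h1 (by omega)).1
        (hJ i h1 (by omega)).2)
  have hIJ : ∀ l i, 1 ≤ l → l ≤ 2 ^ a - 1 → 1 ≤ i → i ≤ n + 1 → I l ≠ J i := by
    intro l i h1 h2 h3 h4 h
    have h5 := hIL l i h1 h2 h3 (by omega)
    rw [h, (hJ i h3 h4).2] at h5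
    exact (hP i h3 h4).2 h5
  -- An interval containing two of the points J contains every point I.
  have hpair : ∀ i i' l s, 1 ≤ i → i < i' → i' ≤ n + 1 → 1 ≤ l → l ≤ 2 ^ a - 1 →
      J i / 2 ^ s = J i' / 2 ^ s → I l / 2 ^ s = J i / 2 ^ s := by
    intro i i' l s h1 h2 h3 h4 h5 h
    have hs : a + i' ≤ s := by
      by_contra hlt
      have h6 := div_two_pow_eq_of_le (t := a + i' - 1) (by omega) h
      rw [hJL i i' h1 h2 (by omega), (hJ i' (by omega) h3).2] at h6
      exact (hP i' (by omega) h3).2 h6.symm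
    refine div_two_pow_eq_of_le (s := a + i' - 1) (by omega) ?_
    rw [hJL i i' h1 h2 (by omega), hIL l i' h4 h5 (by omega) (by omega)]
  have hdisj : Disjoint ((Finset.Icc 1 (2 ^ a - 1)).image I)
      ((Finset.Icc (n + 1 - k) (n + 1)).image J) := by
    rw [Finset.disjoint_left]
    simp only [Finset.mem_image, Finset.mem_Icc]
    rintro _ ⟨l, hl, rfl⟩ ⟨i, hi, h⟩
    exact hIJ l i hl.1 hl.2 (by omega) hi.2 h.symm
  have hcardI : ((Finset.Icc 1 (2 ^ a - 1)).image I).card = 2 ^ a - 1 := by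
    rw [Finset.card_image_of_injOn, Nat.card_Icc, Nat.add_sub_cancel]
    intro x hx y hy h
    simp only [Finset.coe_Icc, Set.mem_Icc] at hx hy
    exact hInj x y hx.1 hx.2 hy.1 hy.2 h
  have hcardJ : ((Finset.Icc (n + 1 - k) (n + 1)).image J).card ≤ n := by
    refine Finset.card_image_le.trans ?_
    rw [Nat.card_Icc]
    omega
  have hd : 1 ≤ 2 ^ a := Nat.one_le_two_pow
  have hmemI : ∀ i : Fin (2 ^ a), i.val ≠ 0 →
      I i.val ∈ (Finset.Icc 1 (2 ^ a - 1)).image I := fun i hi =>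
    Finset.mem_image_of_mem _ (Finset.mem_Icc.2 ⟨by omega, by omega⟩)
  refine ⟨⟨fun i => ?_, fun i₁ i₂ hne => ?_, fun x hx => ?_⟩, fun s _ m _ => ?_⟩
  · dsimp only
    split_ifs with hi
    · exact Finset.subset_union_right
    · exact Finset.singleton_subset_iff.2 (Finset.mem_union_left _ (hmemI i hi))
  · have hv : i₁.val ≠ i₂.val := fun h => hne (Fin.ext h)
    dsimp only
    split_ifs with h₁ h₂ h₂
    · omega
    · exact Finset.disjoint_singleton_right.2 (Finset.disjoint_left.1 hdisj (hmemI i₂ h₂))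
    · exact Finset.disjoint_singleton_left.2 (Finset.disjoint_left.1 hdisj (hmemI i₁ h₁))
    · exact Finset.disjoint_singleton.2 fun h =>
        hv (hInj _ _ (by omega) (by omega) (by omega) (by omega) h)
  · rcases Finset.mem_union.1 hx with hx | hx
    · obtain ⟨l, hl, rfl⟩ := Finset.mem_image.1 hx
      rw [Finset.mem_Icc] at hl
      refine ⟨⟨l, by omega⟩, ?_⟩
      simp [show l ≠ 0 by omega]
    · exact ⟨⟨0, by omega⟩, by simpa using hx⟩
  have hsplit : restrict j s m ((Finset.Icc 1 (2 ^ a - 1)).image I ∪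
        (Finset.Icc (n + 1 - k) (n + 1)).image J) =
      restrict j s m ((Finset.Icc 1 (2 ^ a - 1)).image I) ∪
        restrict j s m ((Finset.Icc (n + 1 - k) (n + 1)).image J) :=
    Finset.filter_union _ _ _
  have hle : ∀ C, (restrict j s m C).card ≤ C.card := fun C => Finset.card_filter_le _ _
  by_cases hJ2 : 1 < (restrict j s m ((Finset.Icc (n + 1 - k) (n + 1)).image J)).card
  · left
    have hall : ∀ l, 1 ≤ l → l ≤ 2 ^ a - 1 → I l / 2 ^ (j - s) = m := by
      intro l hl1 hl2
      obtain ⟨x, hx, y, hy, hxy⟩ := Finset.one_lt_card.1 hJ2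
      simp only [restrict, Finset.mem_filter, Finset.mem_image, Finset.mem_Icc] at hx hy
      obtain ⟨⟨i, hi, rfl⟩, hxm⟩ := hx
      obtain ⟨⟨i', hi', rfl⟩, hym⟩ := hy
      rcases lt_trichotomy i i' with h | rfl | h
      · exact (hpair i i' l _ (by omega) h hi'.2 hl1 hl2 (hxm.trans hym.symm)).trans hxm
      · exact absurd rfl hxy
      · exact (hpair i' i l _ (by omega) h hi.2 hl1 hl2 (hym.trans hxm.symm)).trans hym
    have hIall : restrict j s m ((Finset.Icc 1 (2 ^ a - 1)).image I) =
        (Finset.Icc 1 (2 ^ a - 1)).image I := by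
      refine Finset.filter_true_of_mem fun x hx => ?_
      obtain ⟨l, hl, rfl⟩ := Finset.mem_image.1 hx
      rw [Finset.mem_Icc] at hl
      exact hall l hl.1 hl.2
    refine ⟨?_, fun i₁ i₂ => ?_⟩
    · have hsub : restrict j s m ((Finset.Icc (n + 1 - k) (n + 1)).image J) ⊆
          (Finset.Icc (n + 1 - k) (n + 1)).image J := Finset.filter_subset _ _
      rw [hsplit, hIall, Finset.card_union_of_disjoint (hdisj.mono_right hsub), hcardI]
      omega
    · have hn0 : (0 : ℝ) < n := by exact_mod_cast hn
      have hupper : (restrict j s m (if i₁.val = 0 then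
          (Finset.Icc (n + 1 - k) (n + 1)).image J else {I i₁.val})).card ≤ n := by
        refine (hle _).trans ?_
        split_ifs
        · exact hcardJ
        · simpa using hn
      have hlower : 1 ≤ (restrict j s m (if i₂.val = 0 then
          (Finset.Icc (n + 1 - k) (n + 1)).image J else {I i₂.val})).card := by
        split_ifs with h
        · exact hJ2.le
        · simp [restrict, Finset.filter_singleton, hall i₂.val (by omega) (by omega)]
      calc 1 / (n : ℝ) * _ ≤ 1 / (n : ℝ) * n := by gcongr
        _ = 1 := by field_simp
        _ ≤ _ := by exact_mod_cast hlower
  · right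
    refine ⟨?_, fun i => ?_⟩
    · rw [hsplit]
      refine (Finset.card_union_le _ _).trans ?_
      have := hle ((Finset.Icc 1 (2 ^ a - 1)).image I)
      omega
    · dsimp only
      split_ifs
      · omega
      · simpa using hle {I i.val}
end

section
/- Let {C_i(n-1)} be the (1/n, d)-homogeneous colouring of C(n-1) given by C_1(n-1) = {J_2, …, J_{n+1}} and C_i(n-1) = {I_{i-1}} for 2 ≤ i ≤ d. Then there does NOT exist a (1/n, d)-homogeneous colouring {C_i(n)} of C(n) = C(n-1) ∪ {J_1} satisfying C_i(n-1) ⊆ C_i(n) for all 1 ≤ i ≤ d. -/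
/- Setup for the counterexample of Section 3 (with `d = 2 ^ a`, `η = 1 / n`,
`j ≥ n + a + 1`): a chain of dyadic intervals `L_1 ⊂ L_2 ⊂ … ⊂ L_{n+2}` with
`L_i ∈ D_{j-a-i+1}` (so `L i` is the position of `L_i` at scale `j + 1 - (a + i)`, and
`L_i ⊂ L_{i+1}` reads `L (i+1) = L i / 2`); `P_i = L_{i+1} \ L_i` is the dyadic brother
of `L_i` in `L_{i+1}` (same scale as `L_i`, same parent, different position); pairwise
distinct `I_1, …, I_{d-1} ∈ D_j` with `I_i ⊆ L_1` (i.e. `I i / 2 ^ a = L 1`), and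
`J_1, …, J_{n+1} ∈ D_j` with `J_i ⊆ P_i` (i.e. `J i / 2 ^ (a + i - 1) = P i`).
For `0 ≤ k ≤ n`, `C(k) = {I_1, …, I_{d-1}} ∪ {J_{n-k+1}, …, J_{n+1}}` is encoded as
`(Finset.Icc 1 (2 ^ a - 1)).image I ∪ (Finset.Icc (n + 1 - k) (n + 1)).image J`.
Colour classes are indexed by `i : Fin (2 ^ a)`, index `i` corresponding to colour
`i.val + 1 ∈ {1, …, d}`. -/

/-- If `L (i + 1) = L i / 2` along a chain, then a point lying under `L i` lies under every
later member of the chain. -/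
theorem div_two_pow_eq_of_chain_s7 {a N x i k : ℕ} {L : ℕ → ℕ}
    (hchain : ∀ m, 1 ≤ m → m < N → L (m + 1) = L m / 2) (hi : 1 ≤ i) (hik : i ≤ k) (hk : k ≤ N)
    (hx : x / 2 ^ (a + i - 1) = L i) : x / 2 ^ (a + k - 1) = L k := by
  induction k, hik using Nat.le_induction with
  | base => exact hx
  | succ k hik ih =>
    rw [show a + (k + 1) - 1 = (a + k - 1) + 1 by omega, pow_succ, ← Nat.div_div_eq_div_mul,
      ih (by omega), hchain k (by omega) (by omega)]

/-- **Stage `n`: no consistent extension exists.**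
Let `{C_i(n-1)}` be the `(1/n, d)`-homogeneous colouring of `C(n-1)` given by
`C_1(n-1) = {J_2, …, J_{n+1}}` and `C_i(n-1) = {I_{i-1}}` for `2 ≤ i ≤ d`.  Then there
does not exist a `(1/n, d)`-homogeneous colouring `{C_i(n)}` of `C(n) = C(n-1) ∪ {J_1}`
with `C_i(n-1) ⊆ C_i(n)` for all `1 ≤ i ≤ d`. -/
theorem no_consistent_extension_at_stage_n
    (a n j : ℕ) (hn : 1 ≤ n) (hj : n + a + 1 ≤ j)
    (L P I J : ℕ → ℕ)
    (hL : ∀ i, 1 ≤ i → i ≤ n + 2 → L i < 2 ^ (j + 1 - (a + i)))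
    (hchain : ∀ i, 1 ≤ i → i ≤ n + 1 → L (i + 1) = L i / 2)
    (hP : ∀ i, 1 ≤ i → i ≤ n + 1 → P i / 2 = L i / 2 ∧ P i ≠ L i)
    (hI : ∀ i, 1 ≤ i → i ≤ 2 ^ a - 1 → I i < 2 ^ j ∧ I i / 2 ^ a = L 1)
    (hInj : ∀ i₁ i₂, 1 ≤ i₁ → i₁ ≤ 2 ^ a - 1 → 1 ≤ i₂ → i₂ ≤ 2 ^ a - 1 →
      I i₁ = I i₂ → i₁ = i₂)
    (hJ : ∀ i, 1 ≤ i → i ≤ n + 1 → J i < 2 ^ j ∧ J i / 2 ^ (a + i - 1) = P i)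
    (ha : 1 ≤ a) :
    ¬ ∃ col : Fin (2 ^ a) → Finset ℕ,
      IsHomogeneous j (2 ^ a) (1 / (n : ℝ))
        ((Finset.Icc 1 (2 ^ a - 1)).image I ∪ (Finset.Icc (n + 1 - n) (n + 1)).image J)
        col ∧
      ∀ i : Fin (2 ^ a),
        (if i.val = 0 then (Finset.Icc 2 (n + 1)).image J
          else ({I i.val} : Finset ℕ)) ⊆ col i := by
  rintro ⟨col, ⟨⟨hsub, hdisj, hcov⟩, hhom⟩, hext⟩
  have hd : 2 ≤ 2 ^ a := by simpa using Nat.pow_le_pow_right (n := 2) (by norm_num) ha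
  have hlev : ∀ x i k, 1 ≤ i → i ≤ k → k ≤ n + 2 → x / 2 ^ (a + i - 1) = L i →
      x / 2 ^ (a + k - 1) = L k := fun x i k hi hik hk hx =>
    div_two_pow_eq_of_chain_s7 (N := n + 2) (fun m hm hm' => hchain m hm (by omega)) hi hik hk hx
  have hJL : ∀ i, 1 ≤ i → i ≤ n + 1 → J i / 2 ^ (a + (i + 1) - 1) = L (i + 1) := by
    intro i h1 h2
    rw [show a + (i + 1) - 1 = (a + i - 1) + 1 by omega, pow_succ, ← Nat.div_div_eq_div_mul,
      (hJ i h1 h2).2, (hP i h1 h2).1, hchain i h1 h2]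
  have hJnot : ∀ i k, 1 ≤ i → i ≤ k → 1 ≤ k → k ≤ n + 1 → J k / 2 ^ (a + i - 1) ≠ L i := by
    intro i k hi hik hk hk' h
    have := hlev _ i k hi hik (by omega) h
    exact (hP k hk hk').2 ((hJ k hk hk').2.symm.trans this)
  have hJne : ∀ i k, 1 ≤ i → i < k → k ≤ n + 1 → J i ≠ J k := by
    intro i k hi hik hk h
    exact hJnot (i + 1) k (by omega) hik (by omega) hk (h ▸ hJL i hi (by omega))
  have hJinj : Set.InjOn J (Finset.Icc 1 (n + 1)) := by
    intro x hx y hy hxy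
    simp only [Finset.coe_Icc, Set.mem_Icc] at hx hy
    rcases lt_trichotomy x y with h | h | h
    · exact (hJne x y hx.1 h hy.2 hxy).elim
    · exact h
    · exact (hJne y x hy.1 h hx.2 hxy.symm).elim
  have hIL : ∀ i k, 1 ≤ i → i ≤ 2 ^ a - 1 → 1 ≤ k → k ≤ n + 2 →
      I i / 2 ^ (a + k - 1) = L k := fun i k hi hi' hk hk' =>
    hlev _ 1 k le_rfl hk hk' (by simpa using (hI i hi hi').2)
  have hIcol : ∀ i : Fin (2 ^ a), i.val ≠ 0 → I i.val ∈ col i := by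
    intro i hi
    have := hext i
    rw [if_neg hi] at this
    exact this (Finset.mem_singleton_self _)
  have hzero : (Finset.Icc 2 (n + 1)).image J ⊆ col ⟨0, by omega⟩ := by
    simpa using hext ⟨0, by omega⟩
  obtain ⟨c, hc⟩ := hcov (J 1) (Finset.mem_union_right _
    (Finset.mem_image_of_mem _ (by simp)))
  have hc0 : c.val = 0 := by
    by_contra hc0
    have hci : c.val ≤ 2 ^ a - 1 := by have := c.isLt; omega
    have hne : J 1 ≠ I c.val := fun h =>
      hJnot 1 1 le_rfl le_rfl le_rfl (by omega)
        (h ▸ hIL c.val 1 (by omega) hci le_rfl (by omega))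
    have hscale : j - (j + 1 - (a + 2)) = a + 2 - 1 := by omega
    have htwo : 1 < (restrict j (j + 1 - (a + 2)) (L 2) (col c)).card := by
      refine Finset.one_lt_card.mpr ⟨J 1, ?_, I c.val, ?_, hne⟩
      · exact Finset.mem_filter.mpr ⟨hc, by rw [hscale]; exact hJL 1 le_rfl (by omega)⟩
      · exact Finset.mem_filter.mpr ⟨hIcol c hc0, by
          rw [hscale]; exact hIL c.val 2 (by omega) hci (by omega) (by omega)⟩
    rcases hhom _ (by omega) _ (hL 2 (by omega) (by omega)) with ⟨hbig, -⟩ | ⟨-, hsmall⟩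
    · have hincl : restrict j (j + 1 - (a + 2)) (L 2) ((Finset.Icc 1 (2 ^ a - 1)).image I ∪
          (Finset.Icc (n + 1 - n) (n + 1)).image J) ⊆
          insert (J 1) ((Finset.Icc 1 (2 ^ a - 1)).image I) := by
        intro x hx
        obtain ⟨hx, hxL⟩ := Finset.mem_filter.mp hx
        rcases Finset.mem_union.mp hx with hx | hx
        · exact Finset.mem_insert_of_mem hx
        · obtain ⟨k, hk, rfl⟩ := Finset.mem_image.mp hx
          rw [Finset.mem_Icc] at hk
          rw [hscale] at hxL
          rcases Nat.lt_or_ge k 2 with h | h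
          · obtain rfl : k = 1 := by omega
            exact Finset.mem_insert_self _ _
          · exact (hJnot 2 k (by omega) h (by omega) hk.2 hxL).elim
      have h1 := Finset.card_le_card hincl
      have h2 := Finset.card_insert_le (J 1) ((Finset.Icc 1 (2 ^ a - 1)).image I)
      have h3 := Finset.card_image_le (s := Finset.Icc 1 (2 ^ a - 1)) (f := I)
      rw [Nat.card_Icc] at h3
      omega
    · have := hsmall c
      omega
  rw [show c = ⟨0, by omega⟩ from Fin.ext hc0] at hc
  have hJcol : ∀ k, 1 ≤ k → k ≤ n + 1 → J k ∈ col ⟨0, by omega⟩ := by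
    intro k hk hk'
    rcases hk.eq_or_lt with rfl | h
    · exact hc
    · exact hzero (Finset.mem_image_of_mem _ (Finset.mem_Icc.mpr ⟨h, hk'⟩))
  have hone : col ⟨1, by omega⟩ ⊆ {I 1} := by
    intro x hx
    rcases Finset.mem_union.mp (hsub _ hx) with h | h
    · obtain ⟨k, hk, rfl⟩ := Finset.mem_image.mp h
      rw [Finset.mem_Icc] at hk
      rcases eq_or_ne k 1 with rfl | hk1
      · exact Finset.mem_singleton_self _
      · exact (Finset.disjoint_left.mp (hdisj ⟨k, by omega⟩ ⟨1, by omega⟩ (by simpa using hk1))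
          (hIcol ⟨k, by omega⟩ (by simp; omega)) hx).elim
    · obtain ⟨k, hk, rfl⟩ := Finset.mem_image.mp h
      rw [Finset.mem_Icc] at hk
      exact (Finset.disjoint_left.mp (hdisj ⟨0, by omega⟩ ⟨1, by omega⟩ (by simp))
        (hJcol k (by omega) hk.2) hx).elim
  have hscale : j - (j + 1 - (a + (n + 2))) = a + (n + 2) - 1 := by omega
  have hlow : n + 1 ≤
      (restrict j (j + 1 - (a + (n + 2))) (L (n + 2)) (col ⟨0, by omega⟩)).card := by
    have hincl : (Finset.Icc 1 (n + 1)).image J ⊆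
        restrict j (j + 1 - (a + (n + 2))) (L (n + 2)) (col ⟨0, by omega⟩) := by
      intro x hx
      obtain ⟨k, hk, rfl⟩ := Finset.mem_image.mp hx
      rw [Finset.mem_Icc] at hk
      refine Finset.mem_filter.mpr ⟨hJcol k hk.1 hk.2, ?_⟩
      rw [hscale]
      exact hlev _ (k + 1) (n + 2) (by omega) (by omega) le_rfl (hJL k hk.1 hk.2)
    simpa [Finset.card_image_of_injOn hJinj] using Finset.card_le_card hincl
  have hup : (restrict j (j + 1 - (a + (n + 2))) (L (n + 2)) (col ⟨1, by omega⟩)).card ≤ 1 :=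
    (Finset.card_le_card ((Finset.filter_subset _ _).trans hone)).trans (by simp)
  rcases hhom _ (by omega) _ (hL (n + 2) (by omega) le_rfl) with ⟨-, hbal⟩ | ⟨-, hsmall⟩
  · have hb := hbal ⟨0, by omega⟩ ⟨1, by omega⟩
    have hn' : (0 : ℝ) < n := by exact_mod_cast hn
    rw [one_div, inv_mul_le_iff₀ hn'] at hb
    have hb' : (restrict j (j + 1 - (a + (n + 2))) (L (n + 2)) (col ⟨0, by omega⟩)).card ≤
        n * (restrict j (j + 1 - (a + (n + 2))) (L (n + 2)) (col ⟨1, by omega⟩)).card := by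
      exact_mod_cast hb
    have := Nat.mul_le_mul_left n hup
    omega
  · have := hsmall ⟨0, by omega⟩
    omega
end
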